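/- For an L-layer ReLU network and any choice of sign vectors v_ℓ ∈ {−1, +1}^{n_ℓ} (ℓ = 1, …, L), the set {x ∈ ℝ^{n_0} : (v_ℓ)_i·H^(ℓ)(x)_i ≤ (v_ℓ)_i·G^(ℓ)(x)_i for all ℓ ∈ [L] and all i ∈ [n_ℓ]}, with F^(ℓ), G^(ℓ), H^(ℓ) given by the tropical recurrence, equals the activation region R(v) = {x ∈ ℝ^{n_0} : (v_ℓ)_i·ρ^(ℓ)(x)_i ≤ 0 for all ℓ ∈ [L] and all i ∈ [n_ℓ]}. -/

import Mathlib

open Matrix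

/-- Entrywise positive part of a matrix: entries `max (A i j) 0`. -/
noncomputable def matPos {m n : ℕ} (A : Matrix (Fin m) (Fin n) ℝ) : Matrix (Fin m) (Fin n) ℝ :=
  fun i j => max (A i j) 0

/-- Entrywise negative part of a matrix: entries `max (-A i j) 0`. -/
noncomputable def matNeg {m n : ℕ} (A : Matrix (Fin m) (Fin n) ℝ) : Matrix (Fin m) (Fin n) ℝ :=
  fun i j => max (-A i j) 0

/-- Componentwise ReLU of a vector. -/
noncomputable def relu {m : ℕ} (y : Fin m → ℝ) : Fin m → ℝ := fun i => max (y i) 0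

/-- Componentwise maximum of two vectors. -/
noncomputable def vmax {m : ℕ} (u w : Fin m → ℝ) : Fin m → ℝ := fun i => max (u i) (w i)

/-- Post-activation outputs of a ReLU network with widths `n 0, n 1, …` and layer
parameters `A ℓ : ℝ^{n (ℓ+1) × n ℓ}`, `b ℓ : ℝ^{n (ℓ+1)}`:
`ν⁰(x) = x` and `ν^{ℓ+1}(x) = ReLU (A ℓ · ν^ℓ(x) + b ℓ)`. -/
noncomputable def nu {n : ℕ → ℕ} (A : ∀ ℓ : ℕ, Matrix (Fin (n (ℓ + 1))) (Fin (n ℓ)) ℝ)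
    (b : ∀ ℓ : ℕ, Fin (n (ℓ + 1)) → ℝ) : (ℓ : ℕ) → (Fin (n 0) → ℝ) → (Fin (n ℓ) → ℝ)
  | 0 => fun x => x
  | ℓ + 1 => fun x => relu ((A ℓ).mulVec (nu A b ℓ x) + b ℓ)

/-- Pre-activation output of layer `ℓ+1`: `ρ^{ℓ+1}(x) = A ℓ · ν^ℓ(x) + b ℓ`. -/
noncomputable def rho {n : ℕ → ℕ} (A : ∀ ℓ : ℕ, Matrix (Fin (n (ℓ + 1))) (Fin (n ℓ)) ℝ)
    (b : ∀ ℓ : ℕ, Fin (n (ℓ + 1)) → ℝ) (ℓ : ℕ) (x : Fin (n 0) → ℝ) : Fin (n (ℓ + 1)) → ℝ :=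
  (A ℓ).mulVec (nu A b ℓ x) + b ℓ

/-- The tropical recurrence: `FG ℓ = (F^ℓ, G^ℓ)` with `F⁰(x) = x`, `G⁰(x) = 0`,
`G^{ℓ+1} = A₊ G^ℓ + A₋ F^ℓ`, `H^{ℓ+1} = A₊ F^ℓ + A₋ G^ℓ + b`,
`F^{ℓ+1} = max (H^{ℓ+1}, G^{ℓ+1})` componentwise. -/
noncomputable def FG {n : ℕ → ℕ} (A : ∀ ℓ : ℕ, Matrix (Fin (n (ℓ + 1))) (Fin (n ℓ)) ℝ)
    (b : ∀ ℓ : ℕ, Fin (n (ℓ + 1)) → ℝ) :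
    (ℓ : ℕ) → ((Fin (n 0) → ℝ) → (Fin (n ℓ) → ℝ)) × ((Fin (n 0) → ℝ) → (Fin (n ℓ) → ℝ))
  | 0 => (fun x => x, fun _ => 0)
  | ℓ + 1 =>
      let F := (FG A b ℓ).1
      let G := (FG A b ℓ).2
      let G' := fun x => (matPos (A ℓ)).mulVec (G x) + (matNeg (A ℓ)).mulVec (F x)
      let H' := fun x => (matPos (A ℓ)).mulVec (F x) + (matNeg (A ℓ)).mulVec (G x) + b ℓ
      (fun x => vmax (H' x) (G' x), G')

/-- `H^{ℓ+1}(x) = A₊ F^ℓ(x) + A₋ G^ℓ(x) + b` from the tropical recurrence. -/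
noncomputable def Hfun {n : ℕ → ℕ} (A : ∀ ℓ : ℕ, Matrix (Fin (n (ℓ + 1))) (Fin (n ℓ)) ℝ)
    (b : ∀ ℓ : ℕ, Fin (n (ℓ + 1)) → ℝ) (ℓ : ℕ) (x : Fin (n 0) → ℝ) : Fin (n (ℓ + 1)) → ℝ :=
  (matPos (A ℓ)).mulVec ((FG A b ℓ).1 x) + (matNeg (A ℓ)).mulVec ((FG A b ℓ).2 x) + b ℓ

lemma matPos_sub_matNeg {m n : ℕ} (A : Matrix (Fin m) (Fin n) ℝ) :
    A = matPos A - matNeg A := by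
  ext i j
  simp only [Matrix.sub_apply, matPos, matNeg]
  rcases le_total (A i j) 0 with h | h
  · rw [max_eq_right h, max_eq_left (by linarith)]; ring
  · rw [max_eq_left h, max_eq_right (by linarith)]; ring

lemma step_eq {m n : ℕ} (A : Matrix (Fin m) (Fin n) ℝ) (f g : Fin n → ℝ) (b : Fin m → ℝ) :
    A.mulVec (f - g) + b = ((matPos A).mulVec f + (matNeg A).mulVec g + b) -
      ((matPos A).mulVec g + (matNeg A).mulVec f) := by
  conv_lhs => rw [matPos_sub_matNeg A]
  rw [Matrix.sub_mulVec, Matrix.mulVec_sub, Matrix.mulVec_sub]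
  abel

lemma nu_eq {n : ℕ → ℕ} (A : ∀ ℓ : ℕ, Matrix (Fin (n (ℓ + 1))) (Fin (n ℓ)) ℝ)
    (b : ∀ ℓ : ℕ, Fin (n (ℓ + 1)) → ℝ) (x : Fin (n 0) → ℝ) (ℓ : ℕ) :
    nu A b ℓ x = (FG A b ℓ).1 x - (FG A b ℓ).2 x := by
  induction ℓ with
  | zero => simp [nu, FG]
  | succ k ih =>
    simp only [nu, FG]
    rw [ih, step_eq]
    ext i
    simp only [relu, vmax, Pi.sub_apply]
    rw [← max_sub_sub_right, sub_self]

lemma rho_eq {n : ℕ → ℕ} (A : ∀ ℓ : ℕ, Matrix (Fin (n (ℓ + 1))) (Fin (n ℓ)) ℝ)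
    (b : ∀ ℓ : ℕ, Fin (n (ℓ + 1)) → ℝ) (x : Fin (n 0) → ℝ) (ℓ : ℕ) :
    rho A b ℓ x = Hfun A b ℓ x - (FG A b (ℓ + 1)).2 x := by
  rw [rho, nu_eq, step_eq]
  rfl

/-- For an `L`-layer ReLU network and sign vectors `v ℓ ∈ {−1,+1}^{n (ℓ+1)}` for `ℓ < L`,
the set cut out by the inequalities `(v ℓ)ᵢ H^{ℓ+1}(x)ᵢ ≤ (v ℓ)ᵢ G^{ℓ+1}(x)ᵢ` equals the
activation region `{x : (v ℓ)ᵢ ρ^{ℓ+1}(x)ᵢ ≤ 0 for all ℓ < L, i}`. -/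
theorem tropical_region_eq_activation_region {n : ℕ → ℕ}
    (A : ∀ ℓ : ℕ, Matrix (Fin (n (ℓ + 1))) (Fin (n ℓ)) ℝ)
    (b : ∀ ℓ : ℕ, Fin (n (ℓ + 1)) → ℝ) (L : ℕ)
    (v : ∀ ℓ : Fin L, Fin (n (ℓ.1 + 1)) → ℝ)
    (hv : ∀ ℓ i, v ℓ i = -1 ∨ v ℓ i = 1) :
    {x : Fin (n 0) → ℝ |
        ∀ (ℓ : Fin L) (i : Fin (n (ℓ.1 + 1))),
          v ℓ i * Hfun A b ℓ.1 x i ≤ v ℓ i * (FG A b (ℓ.1 + 1)).2 x i} =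
    {x : Fin (n 0) → ℝ |
        ∀ (ℓ : Fin L) (i : Fin (n (ℓ.1 + 1))),
          v ℓ i * rho A b ℓ.1 x i ≤ 0} := by
  ext x
  simp only [Set.mem_setOf_eq, rho_eq, Pi.sub_apply, mul_sub, sub_nonpos]
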